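/- Let (M,g) be a standard P_l(𝓞)-module. If α ∈ Aut(M) induces the identity on Q_i(M) for every 1 ≤ i ≤ l, then α induces the identity on every quotient I_{i,j}(M)/I_{i,j+1}(M) for 1 ≤ i ≤ j ≤ l. In particular, the kernel of the natural homomorphism ρ : Aut(M) → Aut_𝓞(Q_1(M)) × ⋯ × Aut_𝓞(Q_l(M)) is a nilpotent group. -/

import Mathlib

open NumberField

/-- For an `R`-module endomorphism `g`, `kerPow g i = K_i = ker (g^i)`. -/
def kerPow {R M : Type*} [CommRing R] [AddCommGroup M] [Module R M]
    (g : M →ₗ[R] M) (i : ℕ) : Submodule R M :=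
  LinearMap.ker (g ^ i)

/-- `Isub g i j = I_{i,j} = g^{j-i}(K_j) + K_{i-1}`. -/
def Isub {R M : Type*} [CommRing R] [AddCommGroup M] [Module R M]
    (g : M →ₗ[R] M) (i j : ℕ) : Submodule R M :=
  (kerPow g j).map (g ^ (j - i)) ⊔ kerPow g (i - 1)

/-- `Lsub g i = L_i = g(K_{i+1}) + K_{i-1}`. -/
def Lsub {R M : Type*} [CommRing R] [AddCommGroup M] [Module R M]
    (g : M →ₗ[R] M) (i : ℕ) : Submodule R M :=
  (kerPow g (i + 1)).map g ⊔ kerPow g (i - 1)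

/-- `Qquot g i = Q_i = K_i / L_i` as an `R`-module. -/
abbrev Qquot {R M : Type*} [CommRing R] [AddCommGroup M] [Module R M]
    (g : M →ₗ[R] M) (i : ℕ) :=
  ↥(kerPow g i) ⧸ (Lsub g i).comap (kerPow g i).subtype

/-- A group of automorphisms acting unitriangularly on a finite filtration is nilpotent. -/
theorem nilpotent_of_filtration {R M : Type*} [CommRing R] [AddCommGroup M] [Module R M]
    (H : Subgroup (M ≃ₗ[R] M)) (F : ℕ → Submodule R M) (m : ℕ)
    (hanti : ∀ n, F (n + 1) ≤ F n) (h0 : ∀ x, x ∈ F 0) (hm : F m = ⊥)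
    (hF : ∀ α ∈ H, ∀ n, ∀ x ∈ F n, α x - x ∈ F (n + 1)) : Group.IsNilpotent H := by
  have hpres : ∀ α ∈ H, ∀ n, ∀ x ∈ F n, α x ∈ F n := by
    intro α hα n x hx
    have := (F n).add_mem (hanti n (hF α hα n x hx)) hx
    simpa using this
  let S : ℕ → Subgroup H := fun k =>
    { carrier := {α | ∀ n, ∀ x ∈ F n, (α : M ≃ₗ[R] M) x - x ∈ F (n + (k + 1))}
      one_mem' := by
        intro n x hx
        simp
      mul_mem' := by
        intro a b ha hb n x hx
        have h1 := ha n _ (hpres b b.2 n x hx)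
        have h2 := hb n x hx
        have := (F (n + (k + 1))).add_mem h1 h2
        simpa using this
      inv_mem' := by
        intro a ha n x hx
        have h1 := ha n _ (hpres (a⁻¹ : H) (a⁻¹ : H).2 n x hx)
        have e : (a : M ≃ₗ[R] M) (((a⁻¹ : H) : M ≃ₗ[R] M) x) = x := by
          rw [← LinearEquiv.mul_apply, ← Subgroup.coe_mul]; simp
        rw [e] at h1
        have := (F (n + (k + 1))).neg_mem h1
        rwa [neg_sub] at this }
  have hS : ∀ k (α : H), α ∈ S k ↔
      ∀ n, ∀ x ∈ F n, (α : M ≃ₗ[R] M) x - x ∈ F (n + (k + 1)) := fun k α => Iff.rfl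
  rw [nilpotent_iff_finite_descending_central_series]
  refine ⟨m, S, ⟨?_, ?_⟩, ?_⟩
  · rw [eq_top_iff]
    intro a _
    rw [hS]
    exact hF a a.2
  · intro a k ha b
    rw [commutatorElement_def]
    rw [hS] at ha ⊢
    intro n x hx
    obtain ⟨y, hy⟩ : ∃ y, y = ((a⁻¹ * b⁻¹ : H) : M ≃ₗ[R] M) x := ⟨_, rfl⟩
    have hyF : y ∈ F n := by
      rw [hy]; exact hpres _ (a⁻¹ * b⁻¹ : H).2 n x hx
    have hxy : x = (b : M ≃ₗ[R] M) ((a : M ≃ₗ[R] M) y) := by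
      rw [hy, ← LinearEquiv.mul_apply, ← LinearEquiv.mul_apply, ← Subgroup.coe_mul,
        ← Subgroup.coe_mul]
      simp
    have e : ((a * b * a⁻¹ * b⁻¹ : H) : M ≃ₗ[R] M) x =
        (a : M ≃ₗ[R] M) ((b : M ≃ₗ[R] M) y) := by
      rw [hy, ← LinearEquiv.mul_apply, ← LinearEquiv.mul_apply, ← Subgroup.coe_mul,
        ← Subgroup.coe_mul]
      simp only [mul_assoc]
    rw [e]
    have h1 := ha (n + 1) _ (hF b b.2 n y hyF)
    have h2 := hF b b.2 _ _ (ha n y hyF)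
    rw [show n + 1 + (k + 1) = n + (k + 1 + 1) by ring] at h1
    rw [show n + (k + 1) + 1 = n + (k + 1 + 1) by ring] at h2
    have := (F (n + (k + 1 + 1))).sub_mem h1 h2
    convert this using 1
    rw [hxy, map_sub, map_sub]
    abel
  · rw [eq_bot_iff]
    intro a ha
    rw [hS] at ha
    have hle : ∀ k, F (m + k) ≤ F m := by
      intro k
      induction k with
      | zero => exact le_rfl
      | succ k ih => exact (hanti (m + k)).trans ih
    rw [Subgroup.mem_bot]
    ext x
    have h := ha 0 x (h0 x)
    rw [show 0 + (m + 1) = m + 1 by ring] at h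
    have h' := hle 1 h
    rw [hm, Submodule.mem_bot, sub_eq_zero] at h'
    simpa using h'

theorem mem_kerPow' {R M : Type*} [CommRing R] [AddCommGroup M] [Module R M]
    (g : M →ₗ[R] M) (i : ℕ) (x : M) : x ∈ kerPow g i ↔ (g ^ i) x = 0 := Iff.rfl

theorem comm_pow' {R M : Type*} [CommRing R] [AddCommGroup M] [Module R M]
    (g : M →ₗ[R] M) (α : M ≃ₗ[R] M) (h : ∀ x, α (g x) = g (α x)) (k : ℕ) (x : M) :
    α ((g ^ k) x) = (g ^ k) (α x) := by
  induction k generalizing x with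
  | zero => simp
  | succ k ih => rw [pow_succ, Module.End.mul_apply, Module.End.mul_apply, ih, h]

theorem kerPow_stable {R M : Type*} [CommRing R] [AddCommGroup M] [Module R M]
    (g : M →ₗ[R] M) (α : M ≃ₗ[R] M) (h : ∀ x, α (g x) = g (α x)) (k : ℕ) (x : M)
    (hx : x ∈ kerPow g k) : α x ∈ kerPow g k := by
  rw [mem_kerPow'] at *
  rw [← comm_pow' g α h, hx, map_zero]

theorem Isub_step {R M : Type*} [CommRing R] [AddCommGroup M] [Module R M]
    (g : M →ₗ[R] M) (l : ℕ) (α : M ≃ₗ[R] M) (h : ∀ x, α (g x) = g (α x))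
    (hα : ∀ i, 1 ≤ i → i ≤ l → ∀ x ∈ kerPow g i, α x - x ∈ Lsub g i)
    (i j : ℕ) (hi : 1 ≤ i) (hij : i ≤ j) (hj : j ≤ l) (x : M) (hx : x ∈ Isub g i j) :
    α x - x ∈ Isub g i (j + 1) := by
  obtain ⟨_, ⟨y, hy, rfl⟩, z, hz, rfl⟩ := Submodule.mem_sup.1 hx
  obtain ⟨_, ⟨u, hu, rfl⟩, v, hv, huv⟩ := Submodule.mem_sup.1 (hα j (by omega) hj y hy)
  have e : α ((g ^ (j - i)) y + z) - ((g ^ (j - i)) y + z) =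
      (g ^ (j + 1 - i)) u + ((g ^ (j - i)) v + (α z - z)) := by
    have : (g ^ (j + 1 - i)) u = (g ^ (j - i)) (g u) := by
      rw [show j + 1 - i = j - i + 1 by omega, pow_succ, Module.End.mul_apply]
    rw [this, map_add, comm_pow' g α h, ← add_assoc, ← map_add, huv, map_sub]
    abel
  rw [e]
  refine Submodule.add_mem_sup (Submodule.mem_map_of_mem hu) (Submodule.add_mem _ ?_ ?_)
  · rw [mem_kerPow'] at hv ⊢
    rw [← Module.End.mul_apply, ← pow_add, show i - 1 + (j - i) = j - 1 by omega, hv]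
  · exact Submodule.sub_mem _ (kerPow_stable g α h _ z hz) hz

/-- The subgroup `ker ρ`. -/
def kerRho {R M : Type*} [CommRing R] [AddCommGroup M] [Module R M]
    (g : M →ₗ[R] M) (l : ℕ) : Subgroup (M ≃ₗ[R] M) where
  carrier := {α : M ≃ₗ[R] M | (∀ x, α (g x) = g (α x)) ∧
          ∀ i, 1 ≤ i → i ≤ l → ∀ x ∈ kerPow g i, α x - x ∈ Lsub g i}
  one_mem' := by
    refine ⟨fun x => rfl, fun i _ _ x _ => ?_⟩
    simp
  mul_mem' := by
    rintro a b ⟨ha, ha'⟩ ⟨hb, hb'⟩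
    refine ⟨fun x => ?_, fun i hi hil x hx => ?_⟩
    · rw [LinearEquiv.mul_apply, LinearEquiv.mul_apply, hb, ha]
    · have := (Lsub g i).add_mem (ha' i hi hil _ (kerPow_stable g b hb i x hx))
        (hb' i hi hil x hx)
      simpa using this
  inv_mem' := by
    rintro a ⟨ha, ha'⟩
    have e : ∀ x, a (a⁻¹ x) = x := fun x => a.apply_symm_apply x
    have hc : ∀ x, a⁻¹ (g x) = g (a⁻¹ x) := by
      intro x
      apply a.injective
      rw [ha, e, e]
    refine ⟨hc, fun i hi hil x hx => ?_⟩
    have := (Lsub g i).neg_mem (ha' i hi hil _ (kerPow_stable g a⁻¹ hc i x hx))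
    rwa [e, neg_sub] at this

theorem kerRho_nilpotent' {R M : Type*} [CommRing R] [AddCommGroup M] [Module R M]
    (g : M →ₗ[R] M) (l : ℕ) (hg : g ^ l = 0) : Group.IsNilpotent (kerRho g l) := by
  -- weight filtration: `g^k K_j` has weight `2k - j + l`
  let F : ℕ → Submodule R M := fun n =>
    ⨆ p : {p : ℕ × ℕ // p.2 ≤ l ∧ n + p.2 ≤ 2 * p.1 + l}, (kerPow g p.1.2).map (g ^ p.1.1)
  have hmem : ∀ n k j, j ≤ l → n + j ≤ 2 * k + l → ∀ y ∈ kerPow g j, (g ^ k) y ∈ F n := by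
    intro n k j hj hn y hy
    exact Submodule.mem_iSup_of_mem
      (p := fun p : {p : ℕ × ℕ // p.2 ≤ l ∧ n + p.2 ≤ 2 * p.1 + l} =>
        (kerPow g p.1.2).map (g ^ p.1.1)) ⟨(k, j), hj, hn⟩ (Submodule.mem_map_of_mem hy)
  have hle : ∀ n (N : Submodule R M), (∀ k j, j ≤ l → n + j ≤ 2 * k + l →
      ∀ y ∈ kerPow g j, (g ^ k) y ∈ N) → F n ≤ N := by
    intro n N h
    refine iSup_le ?_
    rintro ⟨⟨k, j⟩, hj, hn⟩
    rintro _ ⟨y, hy, rfl⟩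
    exact h k j hj hn y hy
  have htop : ∀ y, y ∈ kerPow g l := fun y => by rw [mem_kerPow', hg]; rfl
  refine nilpotent_of_filtration (kerRho g l) F (3 * l) ?_ ?_ ?_ ?_
  · exact fun n => hle _ _ fun k j hj hn y hy => hmem n k j hj (by omega) y hy
  · intro x
    simpa using hmem 0 0 l le_rfl (by omega) x (htop x)
  · rw [eq_bot_iff]
    refine hle _ _ fun k j hj hn y hy => ?_
    rw [show k = (k - l) + l by omega, pow_add, hg]
    simp
  · rintro α ⟨h, hα⟩ n
    have key : F n ≤ (F (n + 1)).comap ((α : M →ₗ[R] M) - LinearMap.id) := by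
      refine hle _ _ fun k j hj hn y hy => ?_
      rw [Submodule.mem_comap]
      change α ((g ^ k) y) - (g ^ k) y ∈ F (n + 1)
      rw [comm_pow' g α h, ← map_sub]
      rcases Nat.eq_zero_or_pos j with rfl | hj0
      · have : y = 0 := by simpa [mem_kerPow'] using hy
        simp [this]
      obtain ⟨_, ⟨u, hu, rfl⟩, v, hv, huv⟩ := Submodule.mem_sup.1 (hα j hj0 hj y hy)
      rw [← huv, map_add, ← Module.End.mul_apply, ← pow_succ]
      refine Submodule.add_mem _ ?_ (hmem _ k (j - 1) (by omega) (by omega) v hv)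
      by_cases hjl : j = l
      · exact hmem _ (k + 1) l le_rfl (by omega) u (htop u)
      · exact hmem _ (k + 1) (j + 1) (by omega) (by omega) u hu
    exact fun x hx => key hx

/-- For a standard `P_l(𝓞)`-module `(M,g)`: if an automorphism `α`
(commuting with `g`) induces the identity on every `Q_i`, then it induces the identity on
every quotient `I_{i,j}/I_{i,j+1}` for `1 ≤ i ≤ j ≤ l`. In particular the kernel of
`ρ : Aut(M) → ∏ Aut_𝓞(Q_i)` — the subgroup of automorphisms of `(M,g)` inducing the
identity on all `Q_i` — is a nilpotent group. -/
theorem ker_rho_nilpotent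
    {K : Type*} [Field K] [NumberField K]
    {M : Type*} [AddCommGroup M] [Module (𝓞 K) M]
    [Module.Free ℤ M] [Module.Finite ℤ M]
    (l : ℕ) (hl : 1 ≤ l) (g : M →ₗ[𝓞 K] M) (hg : g ^ l = 0)
    (hstd : ∀ i, 1 ≤ i → i ≤ l → Module.Free (𝓞 K) (Qquot g i)) :
    (∀ α : M ≃ₗ[𝓞 K] M, (∀ x, α (g x) = g (α x)) →
      (∀ i, 1 ≤ i → i ≤ l → ∀ x ∈ kerPow g i, α x - x ∈ Lsub g i) →
      ∀ i j, 1 ≤ i → i ≤ j → j ≤ l → ∀ x ∈ Isub g i j, α x - x ∈ Isub g i (j + 1)) ∧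
    ∃ H : Subgroup (M ≃ₗ[𝓞 K] M),
      (H : Set (M ≃ₗ[𝓞 K] M)) =
        {α : M ≃ₗ[𝓞 K] M | (∀ x, α (g x) = g (α x)) ∧
          ∀ i, 1 ≤ i → i ≤ l → ∀ x ∈ kerPow g i, α x - x ∈ Lsub g i} ∧
      Group.IsNilpotent H := by
  refine ⟨fun α h hα i j hi hij hj x hx => Isub_step g l α h hα i j hi hij hj x hx, ?_⟩
  exact ⟨kerRho g l, rfl, kerRho_nilpotent' g l hg⟩
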